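/- arXiv:2308.04570 — 3 statements merged into one kernel-verified Lean document; each statement's English description precedes it below -/
import Mathlib

section
/- For every symmetric positive definite real d×d matrix A and every real α ≥ 0 one has min{1, d^{(1−α)/2}} · |A|^α ≤ |A^α| ≤ max{1, d^{(1−α)/2}} · |A|^α. -/
open Matrix

/-- The Frobenius inner product `A·B := ∑ i j, A i j * B i j` of two real matrices. -/
noncomputable def fip {d : ℕ} (A B : Matrix (Fin d) (Fin d) ℝ) : ℝ :=
  ∑ i, ∑ j, A i j * B i j

/-- The Frobenius norm `|A| := √(A·A)` of a real matrix. -/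
noncomputable def fnorm {d : ℕ} (A : Matrix (Fin d) (Fin d) ℝ) : ℝ :=
  Real.sqrt (fip A A)

/-- The real power `A^α` of a (symmetric) real matrix, defined through the spectral
decomposition via the continuous functional calculus. -/
noncomputable def mpow {d : ℕ} (A : Matrix (Fin d) (Fin d) ℝ) (α : ℝ) :
    Matrix (Fin d) (Fin d) ℝ :=
  cfc (fun x : ℝ => x ^ α) A

/-- The trace of the functional calculus of a Hermitian matrix is the sum over its eigenvalues. -/
theorem Matrix.IsHermitian.trace_cfc {n : Type*} [Fintype n] [DecidableEq n]
    {A : Matrix n n ℝ} (hA : A.IsHermitian) (f : ℝ → ℝ) :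
    (cfc f A).trace = ∑ i, f (hA.eigenvalues i) := by
  rw [hA.cfc_eq, Matrix.IsHermitian.cfc, Unitary.conjStarAlgAut_apply, trace_mul_comm, ← mul_assoc]
  simp [trace]

theorem fip_self_eq_trace {d : ℕ} (A : Matrix (Fin d) (Fin d) ℝ) :
    fip A A = (A * Aᵀ).trace := by
  simp [fip, trace, mul_apply]

theorem fip_cfc_self {d : ℕ} {A : Matrix (Fin d) (Fin d) ℝ} (hA : A.IsHermitian) (f : ℝ → ℝ) :
    fip (cfc f A) (cfc f A) = ∑ i, f (hA.eigenvalues i) ^ 2 := by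
  have hsymm : (cfc f A)ᵀ = cfc f A := by
    simpa [IsSelfAdjoint, star_eq_conjTranspose] using (cfc_predicate f A : IsSelfAdjoint (cfc f A))
  have hcont (g : ℝ → ℝ) : ContinuousOn g (spectrum ℝ A) :=
    A.finite_real_spectrum.continuousOn g
  rw [fip_self_eq_trace, hsymm, ← cfc_mul f f A (hcont f) (hcont f), hA.trace_cfc]
  simp [sq]

theorem Real.self_mul_rpow_sub_one {x : ℝ} (hx : x ≠ 0) (p : ℝ) : x * x ^ (p - 1) = x ^ p := by
  rw [Real.rpow_sub_one hx, mul_div_cancel₀ _ hx]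

theorem Real.sum_rpow_le_rpow_sum {ι : Type*} (s : Finset ι) {x : ι → ℝ} (hx : ∀ i ∈ s, 0 < x i)
    {p : ℝ} (hp : 1 ≤ p) : ∑ i ∈ s, x i ^ p ≤ (∑ i ∈ s, x i) ^ p := by
  rcases s.eq_empty_or_nonempty with rfl | hs
  · simp [Real.zero_rpow (by linarith : p ≠ 0)]
  have hS : 0 < ∑ i ∈ s, x i := Finset.sum_pos hx hs
  calc ∑ i ∈ s, x i ^ p ≤ ∑ i ∈ s, x i * (∑ j ∈ s, x j) ^ (p - 1) := by
        refine Finset.sum_le_sum fun i hi => ?_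
        rw [← Real.self_mul_rpow_sub_one (hx i hi).ne']
        exact mul_le_mul_of_nonneg_left (Real.rpow_le_rpow (hx i hi).le
          (Finset.single_le_sum (fun j hj => (hx j hj).le) hi) (by linarith)) (hx i hi).le
    _ = (∑ i ∈ s, x i) ^ p := by rw [← Finset.sum_mul, Real.self_mul_rpow_sub_one hS.ne']

theorem Real.rpow_sum_le_sum_rpow {ι : Type*} {s : Finset ι} (hs : s.Nonempty) {x : ι → ℝ}
    (hx : ∀ i ∈ s, 0 < x i) {p : ℝ} (hp : p ≤ 1) :
    (∑ i ∈ s, x i) ^ p ≤ ∑ i ∈ s, x i ^ p := by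
  have hS : 0 < ∑ i ∈ s, x i := Finset.sum_pos hx hs
  calc (∑ i ∈ s, x i) ^ p = ∑ i ∈ s, x i * (∑ j ∈ s, x j) ^ (p - 1) := by
        rw [← Finset.sum_mul, Real.self_mul_rpow_sub_one hS.ne']
    _ ≤ ∑ i ∈ s, x i ^ p := by
        refine Finset.sum_le_sum fun i hi => ?_
        rw [← Real.self_mul_rpow_sub_one (hx i hi).ne' p]
        exact mul_le_mul_of_nonneg_left (Real.rpow_le_rpow_of_nonpos (hx i hi)
          (Finset.single_le_sum (fun j hj => (hx j hj).le) hi) (by linarith)) (hx i hi).le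

theorem Real.sum_rpow_le_card_rpow_mul_rpow_sum {ι : Type*} {s : Finset ι} (hs : s.Nonempty)
    {x : ι → ℝ} (hx : ∀ i ∈ s, 0 ≤ x i) {p : ℝ} (hp₀ : 0 ≤ p) (hp₁ : p ≤ 1) :
    ∑ i ∈ s, x i ^ p ≤ (s.card : ℝ) ^ (1 - p) * (∑ i ∈ s, x i) ^ p := by
  have hc : (0 : ℝ) < s.card := by exact_mod_cast hs.card_pos
  have h := (Real.concaveOn_rpow hp₀ hp₁).le_map_sum (t := s) (w := fun _ => (s.card : ℝ)⁻¹)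
    (p := x) (fun _ _ => by positivity) (by simp [hc.ne']) hx
  simp only [smul_eq_mul, ← Finset.mul_sum] at h
  rw [Real.mul_rpow (by positivity) (Finset.sum_nonneg hx), inv_mul_le_iff₀ hc, ← mul_assoc,
    Real.inv_rpow hc.le] at h
  rwa [Real.rpow_sub hc, Real.rpow_one, div_eq_mul_inv]

/-- For every symmetric positive definite real `d×d` matrix `A` and every real `α ≥ 0`,
`min {1, d^((1−α)/2)} · |A|^α ≤ |A^α| ≤ max {1, d^((1−α)/2)} · |A|^α`. -/
theorem fnorm_mpow_bounds {d : ℕ} (hd : 0 < d)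
    (A : Matrix (Fin d) (Fin d) ℝ) (hA : A.PosDef) (α : ℝ) (hα : 0 ≤ α) :
    min 1 ((d : ℝ) ^ ((1 - α) / 2)) * fnorm A ^ α ≤ fnorm (mpow A α) ∧
      fnorm (mpow A α) ≤ max 1 ((d : ℝ) ^ ((1 - α) / 2)) * fnorm A ^ α := by
  have hne : (Finset.univ : Finset (Fin d)).Nonempty := ⟨⟨0, hd⟩, Finset.mem_univ _⟩
  have hd' : (0 : ℝ) < d := by exact_mod_cast hd
  have hev := hA.eigenvalues_pos
  set ev := hA.1.eigenvalues
  set x : Fin d → ℝ := fun i => ev i ^ 2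
  have hx : ∀ i ∈ Finset.univ, 0 < x i := fun i _ => pow_pos (hev i) 2
  have hS : 0 ≤ ∑ i, x i := Finset.sum_nonneg fun i hi => (hx i hi).le
  have hfA : fnorm A ^ α = √((∑ i, x i) ^ α) := by
    have h := fip_cfc_self hA.1 id
    rw [cfc_id ℝ A hA.1.isSelfAdjoint] at h
    rw [fnorm, h, Real.sqrt_eq_rpow, Real.sqrt_eq_rpow, ← Real.rpow_mul hS, mul_comm α,
      Real.rpow_mul hS]
    rfl
  have hfP : fnorm (mpow A α) = √(∑ i, x i ^ α) := by
    rw [fnorm, mpow, fip_cfc_self hA.1]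
    congr 1
    refine Finset.sum_congr rfl fun i _ => ?_
    rw [Real.rpow_pow_comm (hev i).le]
  have hc : (d : ℝ) ^ ((1 - α) / 2) = √((d : ℝ) ^ (1 - α)) := by
    rw [Real.sqrt_eq_rpow, ← Real.rpow_mul hd'.le]
    ring_nf
  have hmul : (d : ℝ) ^ ((1 - α) / 2) * fnorm A ^ α =
      √((d : ℝ) ^ (1 - α) * (∑ i, x i) ^ α) := by
    rw [hc, hfA, Real.sqrt_mul (by positivity)]
  have hnonneg : 0 ≤ fnorm A ^ α := hfA ▸ Real.sqrt_nonneg _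
  rcases le_total α 1 with h1 | h1
  · constructor
    · refine (mul_le_mul_of_nonneg_right (min_le_left _ _) hnonneg).trans ?_
      rw [one_mul, hfA, hfP]
      exact Real.sqrt_le_sqrt (Real.rpow_sum_le_sum_rpow hne hx h1)
    · refine le_trans ?_ (mul_le_mul_of_nonneg_right (le_max_right _ _) hnonneg)
      rw [hmul, hfP]
      refine Real.sqrt_le_sqrt ?_
      simpa using Real.sum_rpow_le_card_rpow_mul_rpow_sum hne (fun i hi => (hx i hi).le) hα h1
  · constructor
    · refine (mul_le_mul_of_nonneg_right (min_le_right _ _) hnonneg).trans ?_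
      rw [hmul, hfP]
      refine Real.sqrt_le_sqrt ?_
      have h := Real.rpow_sum_le_const_mul_sum_rpow_of_nonneg Finset.univ h1
        (fun i hi => (hx i hi).le)
      rw [Finset.card_univ, Fintype.card_fin] at h
      rw [← neg_sub, Real.rpow_neg hd'.le]
      exact (inv_mul_le_iff₀ (by positivity)).2 h
    · refine le_trans ?_ (mul_le_mul_of_nonneg_right (le_max_left _ _) hnonneg)
      rw [one_mul, hfA, hfP]
      exact Real.sqrt_le_sqrt (Real.sum_rpow_le_rpow_sum _ hx h1)
end

section
/- Let A : ℝ → ℝ^{d×d} take values in the symmetric positive definite matrices and be differentiable at a point t ∈ ℝ, with derivative A'(t), and let α ∈ ℝ with α ≠ −1. Then the function s ↦ tr(A(s)^{α+1}) is differentiable at t and its derivative equals (α+1) · (A'(t) · A(t)^α), where · is the Frobenius inner product. -/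
open Matrix

/-- The matrix logarithm of a (symmetric positive definite) real matrix, defined
spectrally via the continuous functional calculus. -/
noncomputable def mlog {d : ℕ} (A : Matrix (Fin d) (Fin d) ℝ) :
    Matrix (Fin d) (Fin d) ℝ :=
  cfc Real.log A

attribute [local instance] Matrix.frobeniusSeminormedAddCommGroup
  Matrix.frobeniusNormedAddCommGroup Matrix.frobeniusNormedSpace

section Overlap

variable {n : Type*} [Fintype n] [DecidableEq n]

/-- The squared overlaps of the eigenvectors of two real Hermitian matrices. -/
noncomputable def eigenOverlap {A B : Matrix n n ℝ} (hA : A.IsHermitian) (hB : B.IsHermitian)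
    (i j : n) : ℝ :=
  ((star (hA.eigenvectorUnitary : Matrix n n ℝ) * (hB.eigenvectorUnitary : Matrix n n ℝ)) i j) ^ 2

theorem eigenOverlap_nonneg {A B : Matrix n n ℝ} (hA : A.IsHermitian) (hB : B.IsHermitian)
    (i j : n) : 0 ≤ eigenOverlap hA hB i j := sq_nonneg _

theorem sum_eigenOverlap {A B : Matrix n n ℝ} (hA : A.IsHermitian) (hB : B.IsHermitian)
    (j : n) : ∑ i, eigenOverlap hA hB i j = 1 := by
  set W := star (hA.eigenvectorUnitary : Matrix n n ℝ) * (hB.eigenvectorUnitary : Matrix n n ℝ)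
    with hW
  have h : star W * W = 1 :=
    (star hA.eigenvectorUnitary * hB.eigenvectorUnitary).2.1
  have := congrFun (congrFun h j) j
  simp only [Matrix.mul_apply (M := star W), Matrix.star_apply, star_trivial,
    Matrix.one_apply_eq] at this
  simp only [eigenOverlap, ← hW, sq, this]

theorem trace_cfc_mul_cfc {A B : Matrix n n ℝ} (hA : A.IsHermitian) (hB : B.IsHermitian)
    (g h : ℝ → ℝ) :
    (cfc g A * cfc h B).trace =
      ∑ i, ∑ j, eigenOverlap hA hB i j * (g (hA.eigenvalues i) * h (hB.eigenvalues j)) := by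
  rw [hA.cfc_eq, hB.cfc_eq, Matrix.IsHermitian.cfc, Matrix.IsHermitian.cfc,
    Unitary.conjStarAlgAut_apply, Unitary.conjStarAlgAut_apply]
  set U := (hA.eigenvectorUnitary : Matrix n n ℝ)
  set V := (hB.eigenvectorUnitary : Matrix n n ℝ)
  set W := star U * V with hW
  have hW' : star V * U = star W := by simp [hW]
  rw [Matrix.mul_assoc, Matrix.mul_assoc, Matrix.trace_mul_comm]
  have : ∀ G H : Matrix n n ℝ, G * (star U * (V * H * star V)) * U = G * W * (H * star W) := by
    intro G H
    rw [← hW', hW]; simp only [Matrix.mul_assoc]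
  rw [this]
  simp only [Matrix.trace, Matrix.diag, Matrix.mul_apply (M := _ * W), Matrix.diagonal_mul]
  refine Finset.sum_congr rfl fun i _ => Finset.sum_congr rfl fun j _ => ?_
  simp only [eigenOverlap, Matrix.star_apply, Function.comp, star_trivial, RCLike.ofReal_real_eq_id, id]
  ring

theorem trace_cfc_eq_sum_left {A B : Matrix n n ℝ} (hA : A.IsHermitian) (hB : B.IsHermitian)
    (g : ℝ → ℝ) : (cfc g A).trace = ∑ i, ∑ j, eigenOverlap hA hB i j * g (hA.eigenvalues i) := by
  have h := trace_cfc_mul_cfc hA hB g (fun _ => 1)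
  rw [cfc_const_one ℝ B hB.isSelfAdjoint] at h
  simpa using h

theorem trace_cfc_eq_sum_right {A B : Matrix n n ℝ} (hA : A.IsHermitian) (hB : B.IsHermitian)
    (g : ℝ → ℝ) : (cfc g B).trace = ∑ i, ∑ j, eigenOverlap hA hB i j * g (hB.eigenvalues j) := by
  have h := trace_cfc_mul_cfc hA hB (fun _ => 1) g
  rw [cfc_const_one ℝ A hA.isSelfAdjoint] at h
  simpa using h

theorem trace_cfc_mul_sub {A B : Matrix n n ℝ} (hA : A.IsHermitian) (hB : B.IsHermitian)
    (g : ℝ → ℝ) :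
    (cfc g A * (B - A)).trace = ∑ i, ∑ j, eigenOverlap hA hB i j *
      (g (hA.eigenvalues i) * (hB.eigenvalues j - hA.eigenvalues i)) := by
  have h1 := trace_cfc_mul_cfc hA hB g id
  rw [cfc_id ℝ B hB.isSelfAdjoint] at h1
  have h2 := trace_cfc_eq_sum_left hA hB (fun x => g x * id x)
  rw [cfc_mul g id A ((Matrix.finite_real_spectrum).continuousOn g) continuousOn_id,
    cfc_id ℝ A hA.isSelfAdjoint] at h2
  rw [mul_sub, Matrix.trace_sub, h1, h2]
  simp only [← Finset.sum_sub_distrib, id]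
  exact Finset.sum_congr rfl fun i _ => Finset.sum_congr rfl fun j _ => by ring

theorem trace_sub_mul_sub {A B : Matrix n n ℝ} (hA : A.IsHermitian) (hB : B.IsHermitian) :
    ((B - A) * (B - A)).trace = ∑ i, ∑ j, eigenOverlap hA hB i j *
      (hB.eigenvalues j - hA.eigenvalues i) ^ 2 := by
  have h1 := trace_cfc_mul_sub hA hB id
  rw [cfc_id ℝ A hA.isSelfAdjoint] at h1
  have h2 := trace_cfc_mul_cfc hA hB id id
  rw [cfc_id ℝ A hA.isSelfAdjoint, cfc_id ℝ B hB.isSelfAdjoint] at h2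
  have h3 := trace_cfc_eq_sum_right hA hB (fun x => id x * id x)
  rw [cfc_mul id id B continuousOn_id continuousOn_id, cfc_id ℝ B hB.isSelfAdjoint] at h3
  rw [sub_mul, Matrix.trace_sub, h1, mul_sub, Matrix.trace_sub, Matrix.trace_mul_comm B A, h2, h3]
  simp only [← Finset.sum_sub_distrib, id]
  exact Finset.sum_congr rfl fun i _ => Finset.sum_congr rfl fun j _ => by ring

/-- Every eigenvalue of `B` lies within the Frobenius distance of `A` and `B` of some eigenvalue
of `A`. -/
theorem exists_eigenvalue_sq_sub_le {A B : Matrix n n ℝ} (hA : A.IsHermitian)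
    (hB : B.IsHermitian) (j : n) :
    ∃ i, (hB.eigenvalues j - hA.eigenvalues i) ^ 2 ≤ ((B - A) * (B - A)).trace := by
  by_contra! h
  have hle : ∑ i, eigenOverlap hA hB i j * (hB.eigenvalues j - hA.eigenvalues i) ^ 2 ≤
      ((B - A) * (B - A)).trace := by
    rw [trace_sub_mul_sub hA hB]
    exact Finset.sum_le_sum fun i _ => Finset.single_le_sum
      (f := fun j => eigenOverlap hA hB i j * (hB.eigenvalues j - hA.eigenvalues i) ^ 2)
      (fun k _ => mul_nonneg (eigenOverlap_nonneg hA hB i k) (sq_nonneg _)) (Finset.mem_univ j)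
  obtain ⟨i₀, -, hi₀⟩ : ∃ i ∈ Finset.univ, 0 < eigenOverlap hA hB i j :=
    Finset.exists_lt_of_sum_lt (by simp [sum_eigenOverlap hA hB j])
  have hlt : ∑ i, eigenOverlap hA hB i j * ((B - A) * (B - A)).trace <
      ∑ i, eigenOverlap hA hB i j * (hB.eigenvalues j - hA.eigenvalues i) ^ 2 :=
    Finset.sum_lt_sum
      (fun i _ => mul_le_mul_of_nonneg_left (h i).le (eigenOverlap_nonneg hA hB i j))
      ⟨i₀, Finset.mem_univ _, mul_lt_mul_of_pos_left (h i₀) hi₀⟩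
  rw [← Finset.sum_mul, sum_eigenOverlap, one_mul] at hlt
  exact hlt.not_ge hle

end Overlap

theorem fip_eq_trace_mul {d : ℕ} {X : Matrix (Fin d) (Fin d) ℝ} (hX : X.IsHermitian)
    (Y : Matrix (Fin d) (Fin d) ℝ) : fip X Y = (Y * X).trace := by
  simp only [fip, Matrix.trace, Matrix.diag, Matrix.mul_apply]
  refine Finset.sum_congr rfl fun i _ => Finset.sum_congr rfl fun j _ => ?_
  rw [mul_comm, ← hX.apply i j, star_trivial]

theorem Real.exists_abs_rpow_taylor_le (α : ℝ) {m : ℝ} (hm : 0 < m) (M : ℝ) :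
    ∃ C, ∀ x ∈ Set.Icc m M, ∀ y ∈ Set.Icc m M,
      |y ^ (α + 1) - x ^ (α + 1) - (α + 1) * (x ^ α * (y - x))| ≤ C * (y - x) ^ 2 := by
  obtain ⟨C, hC⟩ := isCompact_Icc.exists_bound_of_continuousOn (s := Set.Icc m M)
    (f := fun x : ℝ => (α + 1) * (α * x ^ (α - 1))) (by
      intro x hx
      exact ((Real.continuousAt_rpow_const x _ (Or.inl (hm.trans_le hx.1).ne')).const_mul
        α |>.const_mul (α + 1)).continuousWithinAt)
  refine ⟨C, fun x hx y hy => ?_⟩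
  have hsub : Set.uIcc x y ⊆ Set.Icc m M := Set.uIcc_subset_Icc hx hy
  have hne : ∀ z ∈ Set.Icc m M, z ≠ 0 := fun z hz => (hm.trans_le hz.1).ne'
  have hC0 : 0 ≤ C := (norm_nonneg _).trans (hC x hx)
  have hlip : ∀ z ∈ Set.Icc m M, ‖(α + 1) * z ^ α - (α + 1) * x ^ α‖ ≤ C * ‖z - x‖ :=
    fun z hz => (convex_Icc m M).norm_image_sub_le_of_norm_hasDerivWithin_le
      (fun u hu => ((Real.hasDerivAt_rpow_const
        (Or.inl (hne u hu))).const_mul (α + 1)).hasDerivWithinAt) hC hx hz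
  have key := (convex_uIcc x y).norm_image_sub_le_of_norm_hasDerivWithin_le
    (f := fun z => z ^ (α + 1) - (α + 1) * x ^ α * z) (C := C * |y - x|)
    (f' := fun z => (α + 1) * z ^ α - (α + 1) * x ^ α) (x := x) (y := y)
    (fun u hu => by
      have h1 := Real.hasDerivAt_rpow_const (p := α + 1) (Or.inl (hne u (hsub hu)))
      rw [add_sub_cancel_right] at h1
      simpa only [mul_one, id] using
        (h1.fun_sub ((hasDerivAt_id u).const_mul ((α + 1) * x ^ α))).hasDerivWithinAt)
    (fun z hz => (hlip z (hsub hz)).trans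
      (mul_le_mul_of_nonneg_left (Set.abs_sub_left_of_mem_uIcc hz) hC0))
    Set.left_mem_uIcc Set.right_mem_uIcc
  rw [Real.norm_eq_abs, Real.norm_eq_abs, mul_assoc C, ← sq, sq_abs] at key
  convert key using 2
  ring

/-- A first-order expansion of `B ↦ tr (B ^ (α + 1))` around `A`, with quadratic remainder. -/
theorem Matrix.PosDef.exists_abs_trace_mpow_sub_le {d : ℕ} {A : Matrix (Fin d) (Fin d) ℝ}
    (hA : A.PosDef) (α : ℝ) :
    ∃ C, ∃ δ > 0, ∀ B : Matrix (Fin d) (Fin d) ℝ, B.IsHermitian → fip (B - A) (B - A) < δ →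
      |(mpow B (α + 1)).trace - (mpow A (α + 1)).trace - (α + 1) * fip (B - A) (mpow A α)| ≤
        C * fip (B - A) (B - A) := by
  have hA' := hA.isHermitian
  obtain ⟨m, hm, hmA⟩ : ∃ m > 0, ∀ i, 2 * m ≤ hA'.eigenvalues i := by
    rcases isEmpty_or_nonempty (Fin d) with _ | _
    · exact ⟨1, one_pos, isEmptyElim⟩
    · obtain ⟨i₀, hi₀⟩ := Finite.exists_min hA'.eigenvalues
      exact ⟨hA'.eigenvalues i₀ / 2, half_pos (hA.eigenvalues_pos i₀), fun i => by
        linarith [hi₀ i]⟩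
  obtain ⟨M, hM⟩ := (Set.finite_range hA'.eigenvalues).bddAbove
  replace hM : ∀ i, hA'.eigenvalues i ≤ M := fun i => hM ⟨i, rfl⟩
  obtain ⟨C, hC⟩ := Real.exists_abs_rpow_taylor_le α hm (M + m)
  refine ⟨C, m ^ 2, by positivity, fun B hB hδ => ?_⟩
  have hBA := hB.sub hA'
  rw [fip_eq_trace_mul hBA] at hδ
  have hb : ∀ j, hB.eigenvalues j ∈ Set.Icc m (M + m) := fun j => by
    obtain ⟨i, hi⟩ := exists_eigenvalue_sq_sub_le hA' hB j
    have := abs_le.1 (abs_le_of_sq_le_sq (hi.trans hδ.le) hm.le)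
    constructor <;> linarith [hmA i, hM i]
  rw [fip_eq_trace_mul hBA, fip_eq_trace_mul hBA, mpow, mpow, mpow, trace_cfc_mul_sub hA' hB,
    trace_sub_mul_sub hA' hB, trace_cfc_eq_sum_left hA' hB, trace_cfc_eq_sum_right hA' hB]
  simp only [Finset.mul_sum, ← Finset.sum_sub_distrib]
  refine (Finset.abs_sum_le_sum_abs _ _).trans (Finset.sum_le_sum fun i _ =>
    (Finset.abs_sum_le_sum_abs _ _).trans (Finset.sum_le_sum fun j _ => ?_))
  have h := mul_le_mul_of_nonneg_left (hC (hA'.eigenvalues i)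
      ⟨by linarith [hmA i], by linarith [hM i]⟩ _ (hb j))
    (eigenOverlap_nonneg hA' hB i j)
  rw [← abs_of_nonneg (eigenOverlap_nonneg hA' hB i j), ← abs_mul,
    abs_of_nonneg (eigenOverlap_nonneg hA' hB i j)] at h
  convert h using 1
  · congr 1; ring
  · ring

theorem HasDerivAt.fip {d : ℕ} {A B : ℝ → Matrix (Fin d) (Fin d) ℝ}
    {A' B' : Matrix (Fin d) (Fin d) ℝ} {t : ℝ} (hA : HasDerivAt A A' t) (hB : HasDerivAt B B' t) :
    HasDerivAt (fun s => fip (A s) (B s)) (fip A' (B t) + fip (A t) B') t := by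
  have entry : ∀ {F : ℝ → Matrix (Fin d) (Fin d) ℝ} {F' : Matrix (Fin d) (Fin d) ℝ},
      HasDerivAt F F' t → ∀ i j, HasDerivAt (fun s => F s i j) (F' i j) t := fun hF i j =>
    (Matrix.entryLinearMap ℝ ℝ i j).toContinuousLinearMap.hasFDerivAt.comp_hasDerivAt t hF
  simp only [_root_.fip, ← Finset.sum_add_distrib]
  exact HasDerivAt.fun_sum fun i _ => HasDerivAt.fun_sum fun j _ =>
    (entry hA i j).fun_mul (entry hB i j)

/-- If `A : ℝ → ℝ^{d×d}` takes symmetric positive definite values and is differentiable at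
`t` with derivative `A'`, and `α ≠ −1`, then `s ↦ tr (A(s)^(α+1))` is differentiable at `t`
with derivative `(α+1) · (A' · A(t)^α)`, `·` being the Frobenius inner product. -/
theorem hasDerivAt_trace_mpow {d : ℕ} (hd : 0 < d)
    (A : ℝ → Matrix (Fin d) (Fin d) ℝ) (hA : ∀ s, (A s).PosDef)
    (t : ℝ) (A' : Matrix (Fin d) (Fin d) ℝ) (hdiff : HasDerivAt A A' t)
    (α : ℝ) (hα : α ≠ -1) :
    HasDerivAt (fun s => (mpow (A s) (α + 1)).trace)
      ((α + 1) * fip A' (mpow (A t) α)) t := by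
  have hsub : HasDerivAt (fun s => A s - A t) A' t := hdiff.sub_const (A t)
  have hzero : ∀ Y : Matrix (Fin d) (Fin d) ℝ, fip 0 Y = 0 ∧ fip Y 0 = 0 := by simp [fip]
  have hquad : HasDerivAt (fun s => fip (A s - A t) (A s - A t)) 0 t := by
    simpa [hzero] using hsub.fip hsub
  have hlin : HasDerivAt (fun s => (α + 1) * fip (A s - A t) (mpow (A t) α))
      ((α + 1) * fip A' (mpow (A t) α)) t := by
    simpa [hzero] using (hsub.fip (hasDerivAt_const t (mpow (A t) α))).const_mul (α + 1)
  obtain ⟨C, δ, hδ, hC⟩ := (hA t).exists_abs_trace_mpow_sub_le α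
  have hsmall : ∀ᶠ s in nhds t, fip (A s - A t) (A s - A t) < δ :=
    hquad.continuousAt.eventually_lt_const (by simpa [hzero] using hδ)
  have hrem : HasDerivAt (fun s => (mpow (A s) (α + 1)).trace - (mpow (A t) (α + 1)).trace -
      (α + 1) * fip (A s - A t) (mpow (A t) α)) 0 t := by
    rw [hasDerivAt_iff_isLittleO] at hquad ⊢
    simp only [sub_self, hzero, mul_zero, smul_zero, sub_zero] at hquad ⊢
    refine Asymptotics.IsBigO.trans_isLittleO (Asymptotics.IsBigO.of_bound C ?_) hquad
    filter_upwards [hsmall] with s hs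
    have hnn : 0 ≤ fip (A s - A t) (A s - A t) :=
      Finset.sum_nonneg fun i _ => Finset.sum_nonneg fun j _ => mul_self_nonneg _
    rw [Real.norm_eq_abs, Real.norm_of_nonneg hnn]
    exact hC (A s) (hA s).isHermitian hs
  have h := (hrem.fun_add hlin).add_const (mpow (A t) (α + 1)).trace
  rw [zero_add] at h
  exact h.congr_of_eventuallyEq (Filter.Eventually.of_forall fun s => by ring)
end

section
/- Let A : ℝ → ℝ^{d×d} take values in the symmetric positive definite matrices and be differentiable at a point t ∈ ℝ, and let α ∈ ℝ with α ≠ −1. Then the functions s ↦ A(s)^α and s ↦ A(s)^{(α+1)/2} are differentiable at t, and, denoting derivatives at t by a prime, sign(α) · (A'(t) · (A^α)'(t)) ≥ (4|α|/(α+1)²) · |(A^{(α+1)/2})'(t)|². -/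
open Matrix

attribute [local instance] Matrix.frobeniusSeminormedAddCommGroup
  Matrix.frobeniusNormedAddCommGroup Matrix.frobeniusNormedSpace

namespace Matrix

open Filter Topology

section Continuity

open scoped Matrix.Norms.L2Operator

/-- The continuous functional calculus on symmetric real matrices is continuous in the matrix. -/
theorem tendsto_cfc_of_continuousOn_isOpen {d : ℕ} {X : Type*} {l : Filter X}
    {g : ℝ → ℝ} {U : Set ℝ} (hU : IsOpen U) (hg : ContinuousOn g U)
    {B : X → Matrix (Fin d) (Fin d) ℝ} {B₀ : Matrix (Fin d) (Fin d) ℝ}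
    (hB : Tendsto B l (𝓝 B₀)) (hsa : ∀ x, IsSelfAdjoint (B x)) (hsa₀ : IsSelfAdjoint B₀)
    (hspec : spectrum ℝ B₀ ⊆ U) :
    Tendsto (fun x => cfc g (B x)) l (𝓝 (cfc g B₀)) := by
  obtain ⟨K, ⟨hK₀, hK⟩, hKU⟩ :=
    (spectrum.isCompact (𝕜 := ℝ) B₀).nhdsSet_basis_isCompact.mem_iff.mp
      (hU.mem_nhdsSet.mpr hspec)
  have hev : ∀ᶠ x in l, spectrum ℝ (B x) ⊆ K :=
    (hB.eventually (upperHemicontinuous_spectrum ℝ (Matrix (Fin d) (Fin d) ℝ)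
      |>.upperHemicontinuousAt B₀ _ hK₀)).mono fun _ h => subset_of_mem_nhdsSet h
  exact hB.cfc hK g hev (.of_forall hsa) (subset_of_mem_nhdsSet hK₀) hsa₀ (hg.mono hKU)

end Continuity

/-- A divided-difference inequality for the primitives of a function and of its square. -/
theorem sq_sub_le_of_hasDerivAt_sq {F G k : ℝ → ℝ} {U : Set ℝ} (hU : Convex ℝ U)
    (hF : ∀ x ∈ U, HasDerivAt F (k x ^ 2) x) (hG : ∀ x ∈ U, HasDerivAt G (k x) x)
    {x y : ℝ} (hx : x ∈ U) (hy : y ∈ U) :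
    (G x - G y) ^ 2 ≤ (x - y) * (F x - F y) := by
  wlog hyx : y ≤ x generalizing x y
  · linarith [this hy hx (le_of_not_ge hyx)]
  rcases hyx.eq_or_lt with rfl | hlt
  · simp
  set c := (G x - G y) / (x - y) with hc
  have hmono : MonotoneOn (fun z => F z - 2 * c * G z + c ^ 2 * z) U := by
    have hd : ∀ z ∈ U, HasDerivAt (fun z => F z - 2 * c * G z + c ^ 2 * z)
        (k z ^ 2 - 2 * c * k z + c ^ 2 * 1) z := fun z hz =>
      ((hF z hz).sub ((hG z hz).const_mul _)).add ((hasDerivAt_id z).const_mul _)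
    refine monotoneOn_of_deriv_nonneg hU
      (fun z hz => (hd z hz).continuousAt.continuousWithinAt)
      (fun z hz => (hd z (interior_subset hz)).differentiableAt.differentiableWithinAt)
      fun z hz => ?_
    rw [(hd z (interior_subset hz)).deriv]
    nlinarith [sq_nonneg (k z - c)]
  have h := hmono hy hx hyx
  have hpos : 0 < x - y := sub_pos.mpr hlt
  have hcx : c * (x - y) = G x - G y := by rw [hc]; field_simp
  simp only at h
  have h2 : 0 ≤ (x - y) * ((F x - F y) - 2 * c * (G x - G y) + c ^ 2 * (x - y)) :=
    mul_nonneg hpos.le (by linarith)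
  have h3 : (x - y) * ((F x - F y) - 2 * c * (G x - G y) + c ^ 2 * (x - y))
      = (x - y) * (F x - F y) - (G x - G y) ^ 2 := by
    rw [← hcx]; ring
  linarith

/-- The scalar inequality between the divided differences of `x ↦ x ^ α` and
`x ↦ x ^ ((α + 1) / 2)` on the positive half-line. -/
theorem dslope_rpow_sq_le {α : ℝ} (hα : α ≠ -1) {x y : ℝ} (hx : 0 < x) (hy : 0 < y) :
    4 * |α| / (α + 1) ^ 2 * dslope (fun z : ℝ => z ^ ((α + 1) / 2)) x y ^ 2
      ≤ Real.sign α * dslope (fun z : ℝ => z ^ α) x y := by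
  rcases eq_or_ne α 0 with rfl | hα0
  · simp
  have hα1 : α + 1 ≠ 0 := fun h => hα (by linarith)
  have hsign : |α| = Real.sign α * α := by
    rcases lt_or_gt_of_ne hα0 with h | h
    · simp [Real.sign_of_neg h, abs_of_neg h]
    · simp [Real.sign_of_pos h, abs_of_pos h]
  have hsq : ∀ z : ℝ, 0 < z → (z ^ ((α - 1) / 2)) ^ 2 = z ^ (α - 1) := fun z hz => by
    rw [← Real.rpow_natCast, ← Real.rpow_mul hz.le]; congr 1; push_cast; ring
  rcases eq_or_ne y x with rfl | hyx
  · rw [dslope_same, dslope_same, (Real.hasDerivAt_rpow_const (Or.inl hy.ne')).deriv,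
      (Real.hasDerivAt_rpow_const (Or.inl hy.ne')).deriv,
      show (α + 1) / 2 - 1 = (α - 1) / 2 by ring, mul_pow, hsq y hy, hsign]
    apply le_of_eq
    field_simp
    ring
  · rw [dslope_of_ne _ hyx, dslope_of_ne _ hyx, slope_def_field, slope_def_field]
    have key := sq_sub_le_of_hasDerivAt_sq (F := fun z => z ^ α / α)
      (G := fun z => z ^ ((α + 1) / 2) / ((α + 1) / 2)) (k := fun z => z ^ ((α - 1) / 2))
      (convex_Ioi (0 : ℝ))
      (fun z hz => by
        rw [hsq z hz]
        have := (Real.hasDerivAt_rpow_const (p := α) (Or.inl (ne_of_gt hz))).div_const α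
        rwa [mul_div_cancel_left₀ _ hα0] at this)
      (fun z hz => by
        have := (Real.hasDerivAt_rpow_const (p := (α + 1) / 2)
          (Or.inl (ne_of_gt hz))).div_const ((α + 1) / 2)
        rwa [mul_div_cancel_left₀ _ (by positivity),
          show (α + 1) / 2 - 1 = (α - 1) / 2 by ring] at this)
      (Set.mem_Ioi.mpr hy) (Set.mem_Ioi.mpr hx)
    have hne : y - x ≠ 0 := sub_ne_zero.mpr hyx
    have habs : (0 : ℝ) ≤ |α| / (y - x) ^ 2 := by positivity
    have := mul_le_mul_of_nonneg_left key habs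
    refine le_trans (le_of_eq ?_) (this.trans (le_of_eq ?_))
    · field_simp
      ring
    · rw [hsign]
      field_simp

variable {d : ℕ}

theorem continuousOn_spectrum (B : Matrix (Fin d) (Fin d) ℝ) (g : ℝ → ℝ) :
    ContinuousOn g (spectrum ℝ B) :=
  (finite_real_spectrum (A := B)).continuousOn g

/-- The difference of a function at two symmetric matrices, expanded by means of divided
differences in an eigenbasis of the second one. -/
theorem cfc_sub_cfc_eq_sum {A₀ B : Matrix (Fin d) (Fin d) ℝ} (hA₀ : A₀.IsHermitian)
    (hB : IsSelfAdjoint B) (f : ℝ → ℝ) :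
    cfc f B - cfc f A₀ = ∑ i, (hA₀.eigenvectorUnitary : Matrix (Fin d) (Fin d) ℝ)
      * single i i 1 * star (hA₀.eigenvectorUnitary : Matrix (Fin d) (Fin d) ℝ)
      * ((B - A₀) * cfc (dslope f (hA₀.eigenvalues i)) B) := by
  set U : Matrix (Fin d) (Fin d) ℝ := ↑hA₀.eigenvectorUnitary with hU
  have hUU : star U * U = 1 := Unitary.coe_star_mul_self hA₀.eigenvectorUnitary
  have hUU' : U * star U = 1 := Unitary.coe_mul_star_self hA₀.eigenvectorUnitary
  have hproj : ∀ (g : ℝ → ℝ) (i : Fin d), U * single i i 1 * star U * cfc g A₀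
      = g (hA₀.eigenvalues i) • (U * single i i 1 * star U) := fun g i => by
    rw [hA₀.cfc_eq, IsHermitian.cfc, Unitary.conjStarAlgAut_apply, ← hU]
    calc _ = U * (single i i 1 * ((star U * U) * diagonal (RCLike.ofReal ∘ g ∘ hA₀.eigenvalues)))
          * star U := by simp only [mul_assoc]
      _ = _ := by
        rw [hUU, one_mul]
        have : single i i (1 : ℝ) * diagonal (RCLike.ofReal ∘ g ∘ hA₀.eigenvalues)
            = g (hA₀.eigenvalues i) • single i i 1 := by
          ext a b
          simp only [mul_diagonal, single_apply, smul_apply, Function.comp_apply, smul_eq_mul,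
            RCLike.ofReal_real_eq_id, id_eq]
          split_ifs with h
          · rw [← h.2]; ring
          · simp
        rw [this, mul_smul_comm, smul_mul_assoc]
  have hsum : ∑ i, U * single i i 1 * star U = 1 := by
    rw [← Finset.sum_mul, ← Finset.mul_sum]
    have : ∑ i : Fin d, single i i (1 : ℝ) = 1 := by
      ext a b
      rw [sum_apply, Finset.sum_eq_single a]
      · simp [single_apply, one_apply]
      · intro i _ hi
        simp [hi]
      · simp
    rw [this, mul_one, hUU']
  have hterm : ∀ i, U * single i i 1 * star U * ((B - A₀) * cfc (dslope f (hA₀.eigenvalues i)) B)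
      = U * single i i 1 * star U * (cfc f B - cfc f A₀) := fun i => by
    have h1 : U * single i i 1 * star U * A₀
        = hA₀.eigenvalues i • (U * single i i 1 * star U) := by
      have := hproj id i
      rwa [cfc_id ℝ A₀ hA₀.isSelfAdjoint] at this
    have h2 : cfc (fun x => (x - hA₀.eigenvalues i) * dslope f (hA₀.eigenvalues i) x) B
        = (B - algebraMap ℝ _ (hA₀.eigenvalues i)) * cfc (dslope f (hA₀.eigenvalues i)) B := by
      rw [cfc_mul _ _ B (continuousOn_spectrum B _) (continuousOn_spectrum B _),
        cfc_sub _ _ B (continuousOn_spectrum B _) (continuousOn_spectrum B _),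
        cfc_id' ℝ B hB, cfc_const _ B hB]
    have h3 : cfc (fun x => (x - hA₀.eigenvalues i) * dslope f (hA₀.eigenvalues i) x) B
        = cfc f B - algebraMap ℝ _ (f (hA₀.eigenvalues i)) := by
      rw [← cfc_const _ B hB, ← cfc_sub _ _ B (continuousOn_spectrum B _)
        (continuousOn_spectrum B _)]
      congr 1; ext x
      simpa using sub_smul_dslope f (hA₀.eigenvalues i) x
    rw [mul_sub, hproj, ← mul_assoc, mul_sub, h1]
    rw [h2] at h3
    have := congrArg (fun M => U * single i i 1 * star U * M) h3
    rw [← mul_assoc, mul_sub, mul_sub, Algebra.algebraMap_eq_smul_one,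
      Algebra.algebraMap_eq_smul_one] at this
    simpa using this
  simp only [hterm]
  rw [← Finset.sum_mul, hsum, one_mul]

/-- The Daleckii–Krein formula: in an eigenbasis of `A t`, the derivative of `s ↦ f (A s)` is the
entrywise product of `A'` with the divided differences of `f` at the eigenvalues. -/
theorem hasDerivAt_cfc {A : ℝ → Matrix (Fin d) (Fin d) ℝ} {A' : Matrix (Fin d) (Fin d) ℝ} {t : ℝ}
    (hsa : ∀ s, (A s).IsHermitian) (hdiff : HasDerivAt A A' t) {f : ℝ → ℝ} {V : Set ℝ}
    (hV : IsOpen V) (hf : DifferentiableOn ℝ f V) (hspec : spectrum ℝ (A t) ⊆ V) :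
    HasDerivAt (fun s => cfc f (A s))
      ((hsa t).eigenvectorUnitary * (of fun i j =>
        dslope f ((hsa t).eigenvalues i) ((hsa t).eigenvalues j) *
        (star ((hsa t).eigenvectorUnitary : Matrix (Fin d) (Fin d) ℝ) * A'
          * (hsa t).eigenvectorUnitary) i j)
        * star ((hsa t).eigenvectorUnitary : Matrix (Fin d) (Fin d) ℝ)) t := by
  set U : Matrix (Fin d) (Fin d) ℝ := ↑(hsa t).eigenvectorUnitary with hU
  set lam := (hsa t).eigenvalues
  have hlam : ∀ i, lam i ∈ V := fun i => hspec ((hsa t).eigenvalues_mem_spectrum_real i)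
  have heq : U * (of fun i j => dslope f (lam i) (lam j) * (star U * A' * U) i j) * star U
      = ∑ i, U * single i i 1 * star U * (A' * cfc (dslope f (lam i)) (A t)) := by
    have : ∀ i, U * single i i 1 * star U * (A' * cfc (dslope f (lam i)) (A t))
        = U * (single i i 1 * (star U * A' * U)
          * diagonal (RCLike.ofReal ∘ dslope f (lam i) ∘ lam)) * star U := fun i => by
      rw [(hsa t).cfc_eq, IsHermitian.cfc, Unitary.conjStarAlgAut_apply, ← hU]
      simp only [mul_assoc]; rfl
    simp only [this]
    rw [← Finset.sum_mul, ← Finset.mul_sum]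
    congr 2
    ext a b
    simp only [sum_apply, mul_diagonal, of_apply, Function.comp_apply, RCLike.ofReal_real_eq_id,
      id_eq]
    rw [Finset.sum_eq_single a]
    · simp [mul_comm]
    · intro i _ hi
      simp [hi.symm]
    · simp
  rw [heq]
  refine hasDerivAt_iff_tendsto_slope.mpr ?_
  have hsl : slope (fun s => cfc f (A s)) t = fun s => ∑ i, U * single i i 1 * star U *
      (slope A t s * cfc (dslope f (lam i)) (A s)) := by
    ext1 s
    rw [slope_def_module, cfc_sub_cfc_eq_sum (hsa t) (hsa s), slope_def_module, Finset.smul_sum]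
    simp only [smul_mul_assoc, mul_smul_comm]
    rfl
  have hslope : Tendsto (slope A t) (𝓝[≠] t) (𝓝 A') := hasDerivAt_iff_tendsto_slope.mp hdiff
  have hcont : Tendsto A (𝓝[≠] t) (𝓝 (A t)) :=
    Tendsto.mono_left hdiff.continuousAt nhdsWithin_le_nhds
  have hlim : Tendsto (fun s => ∑ i, U * single i i 1 * star U *
      (slope A t s * cfc (dslope f (lam i)) (A s))) (𝓝[≠] t)
      (𝓝 (∑ i, U * single i i 1 * star U * (A' * cfc (dslope f (lam i)) (A t)))) := by
    refine tendsto_finsetSum _ fun i _ => (hslope.mul ?_).const_mul _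
    refine tendsto_cfc_of_continuousOn_isOpen hV ?_ hcont hsa (hsa t) hspec
    rw [continuousOn_dslope (hV.mem_nhds (hlam i))]
    exact ⟨hf.continuousOn, hf.differentiableAt (hV.mem_nhds (hlam i))⟩
  rw [hsl]
  exact hlim

theorem fip_eq_trace (A B : Matrix (Fin d) (Fin d) ℝ) : fip A B = (Aᵀ * B).trace := by
  simp only [fip, trace, diag, mul_apply, transpose_apply]
  exact Finset.sum_comm

theorem fip_conj (U A B : Matrix (Fin d) (Fin d) ℝ) :
    fip A (U * B * star U) = fip (star U * A * U) B := by
  rw [fip_eq_trace, fip_eq_trace, ← mul_assoc, trace_mul_comm]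
  simp [star_eq_conjTranspose, conjTranspose_eq_transpose_of_trivial, mul_assoc]

theorem fnorm_sq (A : Matrix (Fin d) (Fin d) ℝ) : fnorm A ^ 2 = fip A A :=
  Real.sq_sqrt (Finset.sum_nonneg fun _ _ => Finset.sum_nonneg fun _ _ => mul_self_nonneg _)

end Matrix

/-- If `A : ℝ → ℝ^{d×d}` takes symmetric positive definite values and is differentiable at
`t`, and `α ≠ −1`, then `s ↦ A(s)^α` and `s ↦ A(s)^((α+1)/2)` are differentiable at `t`
and, with primes denoting the derivatives at `t`,
`sign α · (A' · (A^α)') ≥ (4|α|/(α+1)²) · |(A^((α+1)/2))'|²`. -/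
theorem hasDerivAt_mpow_inner_ineq {d : ℕ} (hd : 0 < d)
    (A : ℝ → Matrix (Fin d) (Fin d) ℝ) (hA : ∀ s, (A s).PosDef)
    (t : ℝ) (A' : Matrix (Fin d) (Fin d) ℝ) (hdiff : HasDerivAt A A' t)
    (α : ℝ) (hα : α ≠ -1) :
    ∃ P' H' : Matrix (Fin d) (Fin d) ℝ,
      HasDerivAt (fun s => mpow (A s) α) P' t ∧
      HasDerivAt (fun s => mpow (A s) ((α + 1) / 2)) H' t ∧
      4 * |α| / (α + 1) ^ 2 * fnorm H' ^ 2 ≤ Real.sign α * fip A' P' := by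
  have hsa : ∀ s, (A s).IsHermitian := fun s => (hA s).isHermitian
  have hspec : spectrum ℝ (A t) ⊆ Set.Ioi 0 := by
    rw [(hsa t).spectrum_real_eq_range_eigenvalues]
    rintro _ ⟨i, rfl⟩
    exact (hA t).eigenvalues_pos i
  have hdiffOn : ∀ p : ℝ, DifferentiableOn ℝ (fun x : ℝ => x ^ p) (Set.Ioi 0) := fun p x hx =>
    (Real.differentiableAt_rpow_const_of_ne p (ne_of_gt hx)).differentiableWithinAt
  refine ⟨_, _, Matrix.hasDerivAt_cfc hsa hdiff isOpen_Ioi (hdiffOn α) hspec,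
    Matrix.hasDerivAt_cfc hsa hdiff isOpen_Ioi (hdiffOn ((α + 1) / 2)) hspec, ?_⟩
  set U : Matrix (Fin d) (Fin d) ℝ := ↑(hsa t).eigenvectorUnitary
  have hUU : star U * U = 1 := Unitary.coe_star_mul_self (hsa t).eigenvectorUnitary
  have hcancel : ∀ M : Matrix (Fin d) (Fin d) ℝ, star U * (U * M * star U) * U = M := fun M => by
    calc _ = (star U * U) * M * (star U * U) := by simp only [mul_assoc]
      _ = M := by rw [hUU, one_mul, mul_one]
  rw [Matrix.fnorm_sq, Matrix.fip_conj, Matrix.fip_conj, hcancel]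
  simp only [fip, Finset.mul_sum, of_apply]
  refine Finset.sum_le_sum fun i _ => Finset.sum_le_sum fun j _ => ?_
  nlinarith [mul_le_mul_of_nonneg_right (dslope_rpow_sq_le hα ((hA t).eigenvalues_pos i)
    ((hA t).eigenvalues_pos j)) (sq_nonneg ((star U * A' * U) i j))]
end
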